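/- Fix a Coxeter element C ∈ W and a base Π = {α_1,…,α_r} compatible with C, so that C = s_{i₁} s_{i₂} ⋯ s_{i_r} with each simple reflection occurring exactly once; set τ_C = τ_{i₁} ∘ τ_{i₂} ∘ ⋯ ∘ τ_{i_r} and ⟨x,y⟩ = ((1−C)^{-1}x, y). Then there exists a family (E_α)_{α∈R} of nonzero root vectors E_α ∈ g_α such that [E_α, E_β] = (−1)^{⟨α,β⟩} E_{α+β} whenever α+β ∈ R, [E_α, E_β] = 0 whenever α+β ∉ R and α ≠ −β, and in addition τ_C(E_α) = E_{Cα} for every α ∈ R. -/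

import Mathlib

open RealInnerProductSpace

variable {V : Type*} [NormedAddCommGroup V] [InnerProductSpace ℝ V] [FiniteDimensional ℝ V]

/-- The reflection in the hyperplane orthogonal to a vector `α` with `⟪α, α⟫ = 2`,
as a linear map: `x ↦ x - ⟪α, x⟫ α`. -/
noncomputable def reflLM (α : V) : V →ₗ[ℝ] V :=
  LinearMap.id - ((innerSL ℝ α).toLinearMap).smulRight α

/-- `R` is an irreducible simply-laced (crystallographic, with all roots of squared
length 2) finite root system spanning `V`. -/
structure IsSimplyLacedRootSystem (R : Finset V) : Prop where
  zero_not_mem : (0 : V) ∉ R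
  span_top : Submodule.span ℝ (R : Set V) = ⊤
  norm_two : ∀ α ∈ R, ⟪α, α⟫ = (2 : ℝ)
  inner_int : ∀ α ∈ R, ∀ β ∈ R, ∃ n : ℤ, ⟪α, β⟫ = (n : ℝ)
  reflect_mem : ∀ α ∈ R, ∀ β ∈ R, reflLM α β ∈ R
  irreducible : ∀ S ⊆ R, (∀ α ∈ S, ∀ β ∈ R, β ∉ S → ⟪α, β⟫ = 0) → S = ∅ ∨ S = R

/-- `Δ` is a base (system of simple roots) of the root system `R`: it consists of
roots, it is a linearly independent spanning set, and every root is a nonnegative or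
nonpositive integral combination of elements of `Δ`. -/
def IsBase (R : Finset V) (Δ : Set V) : Prop :=
  Δ ⊆ (R : Set V) ∧
  LinearIndependent ℝ (Subtype.val : Δ → V) ∧
  Submodule.span ℝ Δ = ⊤ ∧
  ∀ β ∈ R, β ∈ AddSubmonoid.closure Δ ∨ -β ∈ AddSubmonoid.closure Δ

/-- A Coxeter element of the Weyl group of `R`: a product of the simple reflections
with respect to some base of `R`, each occurring exactly once. -/
def IsCoxeterElement (R : Finset V) (C : V →ₗ[ℝ] V) : Prop :=
  ∃ l : List V, l.Nodup ∧ IsBase R {x | x ∈ l} ∧ C = (l.map reflLM).prod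

variable {L : Type*} [LieRing L] [LieAlgebra ℂ L] [FiniteDimensional ℂ L]

/-- `gsp` is the root-space decomposition of the finite-dimensional simple complex Lie
algebra `L` with respect to the splitting Cartan subalgebra `H`, with the roots recorded
as the finite set `R ⊂ V` (the real span of the roots) and `χ α : H → ℂ` the complex
linear functional corresponding to `α ∈ R`. -/
structure IsRootSpaceDecomposition (R : Finset V) (H : LieSubalgebra ℂ L)
    (χ : V → H → ℂ) (gsp : V → Submodule ℂ L) : Prop where
  simple : LieAlgebra.IsSimple ℂ L
  cartan : H.IsCartanSubalgebra
  root_space_iff : ∀ α ∈ R, ∀ x : L,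
    x ∈ gsp α ↔ ∀ h : H, ⁅(h : L), x⁆ = χ α h • x
  χ_ne : ∀ α ∈ R, χ α ≠ 0
  finrank_eq_one : ∀ α ∈ R, Module.finrank ℂ (gsp α) = 1
  decomp : H.toSubmodule ⊔ (⨆ α ∈ R, gsp α) = ⊤
  bracket_mem : ∀ α ∈ R, ∀ β ∈ R, α + β ∈ R →
    ∀ x ∈ gsp α, ∀ y ∈ gsp β, ⁅x, y⁆ ∈ gsp (α + β)
  bracket_ne_zero : ∀ α ∈ R, ∀ β ∈ R, α + β ∈ R →
    ∀ x ∈ gsp α, x ≠ 0 → ∀ y ∈ gsp β, y ≠ 0 → ⁅x, y⁆ ≠ 0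
  bracket_eq_zero : ∀ α ∈ R, ∀ β ∈ R, α + β ∉ R → α + β ≠ 0 →
    ∀ x ∈ gsp α, ∀ y ∈ gsp β, ⁅x, y⁆ = 0

variable {I : Type*} [Fintype I] [DecidableEq I]

/-- The exponential of a (nilpotent) endomorphism `a` of the finite-dimensional space `L`:
`exp a = ∑ aⁿ/n!`, where the sum may be truncated at `n = finrank ℂ L` since `a` is
nilpotent. -/
noncomputable def expEnd (a : Module.End ℂ L) : Module.End ℂ L :=
  ∑ n ∈ Finset.range (Module.finrank ℂ L + 1), (n.factorial : ℂ)⁻¹ • a ^ n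

/-- The automorphism `τᵢ = exp(ad eᵢ) ∘ exp(−ad fᵢ) ∘ exp(ad eᵢ)` of `L`, implementing
the simple reflection `sᵢ` on the Cartan subalgebra. -/
noncomputable def chevalleyTau (e f : I → L) (i : I) : Module.End ℂ L :=
  expEnd (LieAlgebra.ad ℂ L (e i)) * expEnd (-(LieAlgebra.ad ℂ L (f i))) *
    expEnd (LieAlgebra.ad ℂ L (e i))

/-- Chevalley generators `eᵢ ∈ g_{αᵢ}`, `fᵢ ∈ g_{-αᵢ}`, `hᵢ = [eᵢ, fᵢ]` for the base
`Π = {Δ i}` of the root system `R` of `L` (the Cartan integers being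
`(Δ i, Δ j)` in the simply-laced normalization `(α, α) = 2`). -/
structure AreChevalleyGenerators (R : Finset V) (gsp : V → Submodule ℂ L)
    (Δ : I → V) (e f h : I → L) : Prop where
  base_mem : ∀ i, Δ i ∈ R
  base_inj : Function.Injective Δ
  base : IsBase R (Set.range Δ)
  e_mem : ∀ i, e i ∈ gsp (Δ i)
  f_mem : ∀ i, f i ∈ gsp (-(Δ i))
  e_ne : ∀ i, e i ≠ 0
  f_ne : ∀ i, f i ≠ 0
  h_eq : ∀ i, h i = ⁅e i, f i⁆
  lie_h_h : ∀ i j, ⁅h i, h j⁆ = 0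
  lie_e_f : ∀ i j, ⁅e i, f j⁆ = if i = j then h i else 0
  lie_h_e : ∀ i j, ⁅h i, e j⁆ = ((⟪Δ i, Δ j⟫ : ℝ) : ℂ) • e j
  lie_h_f : ∀ i j, ⁅h i, f j⁆ = -((⟪Δ i, Δ j⟫ : ℝ) : ℂ) • f j
  ad_e_nilpotent : ∀ i, IsNilpotent (LieAlgebra.ad ℂ L (e i))
  ad_f_nilpotent : ∀ i, IsNilpotent (LieAlgebra.ad ℂ L (f i))

set_option linter.unusedSectionVars false

/-! ### Root combinatorics -/

theorem reflLM_apply' (α x : V) : reflLM α x = x - (⟪α, x⟫ : ℝ) • α := by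
  simp [reflLM]

namespace IsSimplyLacedRootSystem

variable {R : Finset V}

theorem neg_mem (hR : IsSimplyLacedRootSystem R) {α : V} (hα : α ∈ R) : -α ∈ R := by
  have h := hR.reflect_mem α hα α hα
  rw [reflLM_apply', hR.norm_two α hα] at h
  convert h using 1
  module

theorem inner_of_add_mem (hR : IsSimplyLacedRootSystem R) {α β : V} (hα : α ∈ R) (hβ : β ∈ R)
    (h : α + β ∈ R) : (⟪α, β⟫ : ℝ) = -1 := by
  have h1 := hR.norm_two _ h
  rw [real_inner_add_add_self, hR.norm_two α hα, hR.norm_two β hβ] at h1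
  linarith

theorem add_mem_of_inner (hR : IsSimplyLacedRootSystem R) {α β : V} (hα : α ∈ R) (hβ : β ∈ R)
    (h : (⟪α, β⟫ : ℝ) = -1) : α + β ∈ R := by
  have h1 := hR.reflect_mem α hα β hβ
  rw [reflLM_apply', h] at h1
  convert h1 using 1
  module

theorem inner_ge (hR : IsSimplyLacedRootSystem R) {α β : V} (hα : α ∈ R) (hβ : β ∈ R)
    (h : α ≠ -β) : ∃ n : ℤ, (⟪α, β⟫ : ℝ) = n ∧ -1 ≤ n := by
  obtain ⟨n, hn⟩ := hR.inner_int α hα β hβ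
  refine ⟨n, hn, ?_⟩
  have h0 : α + β ≠ 0 := fun h0 => h (eq_neg_of_add_eq_zero_left h0)
  have h1 : 0 < (⟪α + β, α + β⟫ : ℝ) := real_inner_self_pos.2 h0
  rw [real_inner_add_add_self, hR.norm_two α hα, hR.norm_two β hβ, hn] at h1
  have h2 : (-2 : ℝ) < n := by linarith
  have h3 : (-2 : ℤ) < n := by exact_mod_cast h2
  omega

theorem inner_cases (hR : IsSimplyLacedRootSystem R) {α β : V} (hα : α ∈ R) (hβ : β ∈ R) :
    α = β ∨ α = -β ∨ (⟪α, β⟫ : ℝ) = -1 ∨ (⟪α, β⟫ : ℝ) = 0 ∨ (⟪α, β⟫ : ℝ) = 1 := by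
  by_cases h1 : α = β
  · exact Or.inl h1
  by_cases h2 : α = -β
  · exact Or.inr (Or.inl h2)
  obtain ⟨n, hn, hn1⟩ := hR.inner_ge hα hβ h2
  obtain ⟨m, hm, hm1⟩ := hR.inner_ge hα (hR.neg_mem hβ) (by simpa using h1)
  rw [inner_neg_right, hn] at hm
  have : -n = m := by exact_mod_cast hm
  have h3 : n = -1 ∨ n = 0 ∨ n = 1 := by omega
  rw [hn]
  right; right
  rcases h3 with h | h | h <;> simp [h]

end IsSimplyLacedRootSystem

/-- The properties of the sign cocycle `(-1)^⟨α, β⟩` used in the construction. -/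
structure IsSignCocycle (R : Finset V) (ε : V → V → ℂ) : Prop where
  add_left : ∀ a b c, ε (a + b) c = ε a c * ε b c
  add_right : ∀ a b c, ε a (b + c) = ε a b * ε a c
  neg_left : ∀ α ∈ R, ∀ β ∈ R, ε (-α) β = ε α β
  neg_right : ∀ α ∈ R, ∀ β ∈ R, ε α (-β) = ε α β
  sq : ∀ α ∈ R, ∀ β ∈ R, ε α β * ε α β = 1
  self : ∀ α ∈ R, ε α α = -1
  skew : ∀ α ∈ R, ∀ β ∈ R, α + β ∈ R → ε β α = -ε α β

section Construction

variable {R : Finset V} {H : LieSubalgebra ℂ L} {χ : V → H → ℂ} {gsp : V → Submodule ℂ L}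

theorem exists_smul_of_mem (hg : IsRootSpaceDecomposition R H χ gsp) {α : V} (hα : α ∈ R)
    {x y : L} (hx : x ∈ gsp α) (hx0 : x ≠ 0) (hy : y ∈ gsp α) : ∃ c : ℂ, y = c • x := by
  have h := (finrank_eq_one_iff_of_nonzero' (⟨x, hx⟩ : gsp α)
    (by simpa [Subtype.ext_iff] using hx0)).1 (hg.finrank_eq_one α hα) ⟨y, hy⟩
  obtain ⟨c, hc⟩ := h
  exact ⟨c, by simpa using (congrArg Subtype.val hc).symm⟩

/-- Partial associativity of the bracket along a chain of roots. -/
theorem lie_assoc_of_roots (hR : IsSimplyLacedRootSystem R)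
    (hg : IsRootSpaceDecomposition R H χ gsp) {α β γ : V}
    (hα : α ∈ R) (hβ : β ∈ R) (hγ : γ ∈ R) (h1 : α + β ∈ R) (h2 : β + γ ∈ R)
    (h3 : α + β + γ ∈ R) {x y z : L} (hx : x ∈ gsp α) (hz : z ∈ gsp γ) :
    ⁅⁅x, y⁆, z⁆ = ⁅x, ⁅y, z⁆⁆ := by
  have e1 := hR.inner_of_add_mem hα hβ h1
  have e2 := hR.inner_of_add_mem hβ hγ h2
  have e3 := hR.inner_of_add_mem h1 hγ h3
  rw [inner_add_left, e2] at e3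
  have e4 : (⟪α, γ⟫ : ℝ) = 0 := by linarith
  have h0 : ⁅x, z⁆ = 0 := by
    refine hg.bracket_eq_zero α hα γ hγ ?_ ?_ x hx z hz
    · intro h
      have := hR.inner_of_add_mem hα hγ h
      linarith
    · intro h
      rw [eq_neg_of_add_eq_zero_left h, inner_neg_left, hR.norm_two γ hγ] at e4
      norm_num at e4
  rw [lie_lie, h0, lie_zero, sub_zero]

/-- Consistency of the two decompositions of a root, in the ordered situation. -/
theorem decomp_consistent_aux (hR : IsSimplyLacedRootSystem R)
    (hg : IsRootSpaceDecomposition R H χ gsp) {ε : V → V → ℂ} (hε : IsSignCocycle R ε)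
    {E : V → L} {β' δ γ : V}
    (hβ' : β' ∈ R) (hδ : δ ∈ R) (hγ : γ ∈ R) (h1 : β' + δ ∈ R) (h2 : δ + γ ∈ R)
    (h3 : β' + δ + γ ∈ R) (m1 : E β' ∈ gsp β') (m3 : E γ ∈ gsp γ)
    (b1 : ⁅E β', E δ⁆ = ε β' δ • E (β' + δ)) (b2 : ⁅E δ, E γ⁆ = ε δ γ • E (δ + γ)) :
    ε (β' + δ) γ • ⁅E (β' + δ), E γ⁆ = ε β' (δ + γ) • ⁅E β', E (δ + γ)⁆ := by
  have h := lie_assoc_of_roots hR hg hβ' hδ hγ h1 h2 h3 (y := E δ) m1 m3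
  rw [b1, b2, smul_lie, lie_smul] at h
  rw [hε.add_left, hε.add_right]
  have s1 := hε.sq _ hβ' _ hδ
  have s2 := hε.sq _ hδ _ hγ
  calc (ε β' γ * ε δ γ) • ⁅E (β' + δ), E γ⁆
      = (ε β' γ * ε δ γ * ε β' δ) • (ε β' δ • ⁅E (β' + δ), E γ⁆) := by
        rw [smul_smul]; congr 1; linear_combination (-(ε β' γ * ε δ γ)) * s1
    _ = _ := by
        rw [h, smul_smul]; congr 1; linear_combination (ε β' γ * ε β' δ) * s2

theorem decomp_consistent (hR : IsSimplyLacedRootSystem R)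
    (hg : IsRootSpaceDecomposition R H χ gsp) {ε : V → V → ℂ} (hε : IsSignCocycle R ε)
    {E : V → L} (ht : V →ₗ[ℝ] ℝ) (hne : ∀ α ∈ R, ht α ≠ 0) (n : ℝ)
    (hmem : ∀ α ∈ R, 0 < ht α → ht α < n → E α ∈ gsp α)
    (hbr : ∀ β ∈ R, ∀ γ ∈ R, 0 < ht β → 0 < ht γ → β + γ ∈ R → ht (β + γ) < n →
      ⁅E β, E γ⁆ = ε β γ • E (β + γ))
    {β γ β' γ' : V} (hβ : β ∈ R) (hγ : γ ∈ R) (hβ' : β' ∈ R) (hγ' : γ' ∈ R)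
    (pβ : 0 < ht β) (pγ : 0 < ht γ) (pβ' : 0 < ht β') (pγ' : 0 < ht γ')
    (hs : β + γ ∈ R) (heq : β + γ = β' + γ') (hn : ht (β + γ) = n) :
    ε β γ • ⁅E β, E γ⁆ = ε β' γ' • ⁅E β', E γ'⁆ := by
  -- the basic case
  have key : ∀ β ∈ R, ∀ γ ∈ R, ∀ β' ∈ R, ∀ γ' ∈ R, 0 < ht β → 0 < ht γ → 0 < ht β' → 0 < ht γ' →
      β + γ ∈ R → β + γ = β' + γ' → ht (β + γ) = n → (⟪β, β'⟫ : ℝ) = 1 → 0 < ht (β - β') →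
      ε β γ • ⁅E β, E γ⁆ = ε β' γ' • ⁅E β', E γ'⁆ := by
    intro β hβ γ hγ β' hβ' γ' hγ' pβ pγ pβ' pγ' hs heq hn hin hpos
    have hδ : β - β' ∈ R := by
      have := hR.add_mem_of_inner hβ (hR.neg_mem hβ') (by rw [inner_neg_right, hin])
      rwa [← sub_eq_add_neg] at this
    obtain ⟨δ, rfl⟩ : ∃ δ, β = β' + δ := ⟨β - β', by abel⟩
    have hγ'e : γ' = δ + γ := by
      have : β' + (δ + γ) = β' + γ' := by rw [← heq]; abel
      exact (add_left_cancel this).symm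
    subst hγ'e
    rw [add_sub_cancel_left] at hδ hpos
    rw [map_add] at hn pβ pγ'
    rw [map_add] at hn
    refine decomp_consistent_aux hR hg hε hβ' hδ hγ hβ hγ' hs
      (hmem _ hβ' pβ' (by linarith)) (hmem _ hγ pγ (by linarith)) ?_ ?_
    · exact hbr _ hβ' _ hδ pβ' hpos hβ (by rw [map_add]; linarith)
    · exact hbr _ hδ _ hγ hpos pγ hγ' (by rw [map_add]; linarith)
  have key2 : ∀ β ∈ R, ∀ γ ∈ R, ∀ β' ∈ R, ∀ γ' ∈ R, 0 < ht β → 0 < ht γ → 0 < ht β' → 0 < ht γ' →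
      β + γ ∈ R → β + γ = β' + γ' → ht (β + γ) = n → (⟪β, β'⟫ : ℝ) = 1 →
      ε β γ • ⁅E β, E γ⁆ = ε β' γ' • ⁅E β', E γ'⁆ := by
    intro β hβ γ hγ β' hβ' γ' hγ' pβ pγ pβ' pγ' hs heq hn hin
    have hδ : β - β' ∈ R := by
      have := hR.add_mem_of_inner hβ (hR.neg_mem hβ') (by rw [inner_neg_right, hin])
      rwa [← sub_eq_add_neg] at this
    rcases lt_or_gt_of_ne (hne _ hδ) with h | h
    · refine (key β' hβ' γ' hγ' β hβ γ hγ pβ' pγ' pβ pγ (heq ▸ hs) heq.symm (heq ▸ hn) ?_ ?_).symm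
      · rw [real_inner_comm, hin]
      · rw [← neg_sub, map_neg]; linarith
    · exact key β hβ γ hγ β' hβ' γ' hγ' pβ pγ pβ' pγ' hs heq hn hin h
  have swap : ∀ β ∈ R, ∀ γ ∈ R, β + γ ∈ R → ε β γ • ⁅E β, E γ⁆ = ε γ β • ⁅E γ, E β⁆ := by
    intro β hβ γ hγ h
    rw [hε.skew β hβ γ hγ h, ← lie_skew (E β) (E γ), smul_neg, neg_smul]
  have hi1 : (⟪β, β'⟫ : ℝ) + ⟪β, γ'⟫ = 1 := by
    rw [← inner_add_right, ← heq, inner_add_right, hR.norm_two β hβ,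
      hR.inner_of_add_mem hβ hγ hs]
    norm_num
  have npos : ∀ x y : V, 0 < ht x → 0 < ht y → x ≠ -y := by
    intro x y hx hy h
    rw [h, map_neg] at hx
    linarith
  rcases hR.inner_cases hβ hβ' with h | h | h | h | h
  · subst h
    obtain rfl := add_left_cancel heq
    rfl
  · exact absurd h (npos _ _ pβ pβ')
  · -- then `⟪β, γ'⟫ = 2`
    have h2 : (⟪β, γ'⟫ : ℝ) = 2 := by linarith
    rcases hR.inner_cases hβ hγ' with h' | h' | h' | h' | h'
    · subst h'
      have : γ = β' := by
        rw [add_comm β' β] at heq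
        exact add_left_cancel heq
      subst this
      exact swap _ hβ _ hγ hs
    · exact absurd h' (npos _ _ pβ pγ')
    all_goals (rw [h'] at h2; norm_num at h2)
  · rw [swap β' hβ' γ' hγ' (heq ▸ hs)]
    exact key2 β hβ γ hγ γ' hγ' β' hβ' pβ pγ pγ' pβ' hs (by rw [heq, add_comm]) hn (by linarith)
  · exact key2 β hβ γ hγ β' hβ' γ' hγ' pβ pγ pβ' pγ' hs heq hn h

/-- Construction of normalized root vectors on a positive system. -/
theorem exists_pos_basis (hR : IsSimplyLacedRootSystem R)
    (hg : IsRootSpaceDecomposition R H χ gsp) {ε : V → V → ℂ} (hε : IsSignCocycle R ε)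
    (ht : V →ₗ[ℝ] ℝ) (hintg : ∀ α ∈ R, ∃ n : ℤ, ht α = n) (hne : ∀ α ∈ R, ht α ≠ 0)
    (x : V → L) (hx : ∀ α ∈ R, x α ∈ gsp α ∧ x α ≠ 0) :
    ∃ E : V → L, (∀ α ∈ R, 0 < ht α → E α ∈ gsp α ∧ E α ≠ 0) ∧
      (∀ β ∈ R, ∀ γ ∈ R, 0 < ht β → 0 < ht γ → β + γ ∈ R → ⁅E β, E γ⁆ = ε β γ • E (β + γ)) ∧
      (∀ α ∈ R, 0 < ht α → (∀ β ∈ R, ∀ γ ∈ R, 0 < ht β → 0 < ht γ → α ≠ β + γ) →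
        E α = x α) := by
  classical
  have main : ∀ n : ℕ, ∃ E : V → L,
      (∀ α ∈ R, 0 < ht α → ht α < n → E α ∈ gsp α ∧ E α ≠ 0) ∧
      (∀ β ∈ R, ∀ γ ∈ R, 0 < ht β → 0 < ht γ → β + γ ∈ R → ht (β + γ) < n →
        ⁅E β, E γ⁆ = ε β γ • E (β + γ)) ∧
      (∀ α ∈ R, 0 < ht α → ht α < n → (∀ β ∈ R, ∀ γ ∈ R, 0 < ht β → 0 < ht γ → α ≠ β + γ) →
        E α = x α) := by
    intro n
    induction n with
    | zero =>
      refine ⟨x, ?_, ?_, ?_⟩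
      · intro α _ h1 h2; exact hx α ‹_›
      · intro β _ γ _ h1 h2 _ h3; rw [map_add] at h3; push_cast at h3; linarith
      · intros; rfl
    | succ n ih =>
      obtain ⟨E, hE1, hE2, hE3⟩ := ih
      let dec : V → V × V → Prop := fun α p => p.1 ∈ R ∧ p.2 ∈ R ∧ 0 < ht p.1 ∧ 0 < ht p.2 ∧
        α = p.1 + p.2
      let F : V → L := fun α => if ht α < n then E α else
        if h : ∃ p, dec α p then ε h.choose.1 h.choose.2 • ⁅E h.choose.1, E h.choose.2⁆ else x α
      have hFlt : ∀ α, ht α < n → F α = E α := fun α h => if_pos h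
      have hF : ∀ β ∈ R, ∀ γ ∈ R, 0 < ht β → 0 < ht γ → β + γ ∈ R → ht (β + γ) = n →
          F (β + γ) = ε β γ • ⁅E β, E γ⁆ := by
        intro β hβ γ hγ pβ pγ hs hn
        have hex : ∃ p, dec (β + γ) p := ⟨(β, γ), hβ, hγ, pβ, pγ, rfl⟩
        have h1 : F (β + γ) = ε hex.choose.1 hex.choose.2 • ⁅E hex.choose.1, E hex.choose.2⁆ := by
          simp only [F]
          rw [if_neg (by rw [hn]; exact lt_irrefl _), dif_pos hex]
        obtain ⟨c1, c2, c3, c4, c5⟩ := hex.choose_spec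
        rw [h1]
        exact (decomp_consistent hR hg hε ht hne n (fun α a b c => (hE1 α a b c).1) hE2
          hβ hγ c1 c2 pβ pγ c3 c4 hs c5 hn).symm
      have hFx : ∀ α ∈ R, ht α = n → (∀ β ∈ R, ∀ γ ∈ R, 0 < ht β → 0 < ht γ → α ≠ β + γ) →
          F α = x α := by
        intro α hα hn hno
        simp only [F]
        rw [if_neg (by rw [hn]; exact lt_irrefl _), dif_neg]
        rintro ⟨p, c1, c2, c3, c4, c5⟩
        exact hno _ c1 _ c2 c3 c4 c5
      have hle : ∀ α ∈ R, ht α < (n + 1 : ℕ) → ht α < n ∨ ht α = n := by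
        intro α hα h
        obtain ⟨m, hm⟩ := hintg α hα
        rw [hm] at h ⊢
        have h' : m < n + 1 := by exact_mod_cast h
        rcases lt_or_eq_of_le (show m ≤ n by omega) with h2 | h2
        · left; exact_mod_cast h2
        · right; exact_mod_cast h2
      refine ⟨F, ?_, ?_, ?_⟩
      · intro α hα pα hlt
        rcases hle α hα hlt with h | h
        · rw [hFlt α h]; exact hE1 α hα pα h
        · by_cases hd : ∃ p, dec α p
          · obtain ⟨⟨β, γ⟩, c1, c2, c3, c4, c5⟩ := hd
            simp only at c1 c2 c3 c4 c5
            subst c5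
            rw [hF β c1 γ c2 c3 c4 hα h]
            rw [map_add] at h
            have m1 := hE1 β c1 c3 (by linarith)
            have m2 := hE1 γ c2 c4 (by linarith)
            refine ⟨Submodule.smul_mem _ _ (hg.bracket_mem β c1 γ c2 hα _ m1.1 _ m2.1), ?_⟩
            refine smul_ne_zero ?_ (hg.bracket_ne_zero β c1 γ c2 hα _ m1.1 m1.2 _ m2.1 m2.2)
            intro h0
            have := hε.sq β c1 γ c2
            rw [h0] at this
            simp at this
          · rw [hFx α hα h]
            · exact hx α hα
            · intro β hβ γ hγ pβ pγ e
              exact hd ⟨(β, γ), hβ, hγ, pβ, pγ, e⟩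
      · intro β hβ γ hγ pβ pγ hs hlt
        have hsum : ht (β + γ) = ht β + ht γ := map_add _ _ _
        rcases hle _ hs hlt with h | h
        · rw [hFlt β (by linarith), hFlt γ (by linarith), hFlt _ h]
          exact hE2 β hβ γ hγ pβ pγ hs h
        · rw [hFlt β (by linarith), hFlt γ (by linarith), hF β hβ γ hγ pβ pγ hs h, smul_smul,
            hε.sq β hβ γ hγ, one_smul]
      · intro α hα pα hlt hno
        rcases hle α hα hlt with h | h
        · rw [hFlt α h]; exact hE3 α hα pα h hno
        · exact hFx α hα h hno
  obtain ⟨M, hM⟩ := (R.image ht).exists_le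
  obtain ⟨n, hn⟩ := exists_nat_gt M
  have hlt : ∀ α ∈ R, ht α < n := fun α hα =>
    lt_of_le_of_lt (hM _ (Finset.mem_image_of_mem _ hα)) hn
  obtain ⟨E, h1, h2, h3⟩ := main n
  exact ⟨E, fun α hα p => h1 α hα p (hlt α hα),
    fun β hβ γ hγ pβ pγ hs => h2 β hβ γ hγ pβ pγ hs (hlt _ hs),
    fun α hα p => h3 α hα p (hlt α hα)⟩

end Construction

/-! ### Bases and heights -/

section Base

variable {R : Finset V} {Δ : I → V}

/-- The vector space basis attached to a base of the root system. -/
theorem exists_basis_of_isBase (hinj : Function.Injective Δ) (hb : IsBase R (Set.range Δ)) :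
    ∃ b : Module.Basis I ℝ V, ∀ i, b i = Δ i := by
  obtain ⟨_, h2, h3, _⟩ := hb
  have hli : LinearIndependent ℝ Δ := (linearIndepOn_id_range_iff hinj).1 h2
  exact ⟨Module.Basis.mk hli h3.ge, fun i => by simp⟩

theorem closure_height {ht : V →ₗ[ℝ] ℝ} (hht : ∀ i, ht (Δ i) = 1) {x : V}
    (hx : x ∈ AddSubmonoid.closure (Set.range Δ)) :
    (∃ n : ℕ, ht x = n) ∧ (x = 0 ∨ 1 ≤ ht x) := by
  induction hx using AddSubmonoid.closure_induction with
  | mem x hx =>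
    obtain ⟨i, rfl⟩ := hx
    exact ⟨⟨1, by simp [hht]⟩, Or.inr (hht i).ge⟩
  | zero => exact ⟨⟨0, by simp⟩, Or.inl rfl⟩
  | add x y _ _ hx hy =>
    obtain ⟨⟨n, hn⟩, hx⟩ := hx
    obtain ⟨⟨m, hm⟩, hy⟩ := hy
    refine ⟨⟨n + m, by simp [hn, hm]⟩, ?_⟩
    rcases hx with rfl | hx
    · rcases hy with rfl | hy
      · left; simp
      · right; simpa using hy
    · right
      rw [map_add, hm]
      have : (0 : ℝ) ≤ m := Nat.cast_nonneg m
      linarith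

theorem root_height (hR : IsSimplyLacedRootSystem R) (hb : IsBase R (Set.range Δ))
    {ht : V →ₗ[ℝ] ℝ} (hht : ∀ i, ht (Δ i) = 1) {α : V} (hα : α ∈ R) :
    (∃ n : ℤ, ht α = n) ∧ ht α ≠ 0 ∧
      (0 < ht α → 1 ≤ ht α ∧ α ∈ AddSubmonoid.closure (Set.range Δ)) ∧ (ht α < 0 → ht α ≤ -1) := by
  have h0 : α ≠ 0 := fun h => hR.zero_not_mem (h ▸ hα)
  rcases hb.2.2.2 α hα with h | h
  · obtain ⟨⟨n, hn⟩, h1⟩ := closure_height hht h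
    have h2 := h1.resolve_left h0
    exact ⟨⟨n, by simpa using hn⟩, by linarith, fun _ => ⟨h2, h⟩, fun _ => by linarith⟩
  · obtain ⟨⟨n, hn⟩, h1⟩ := closure_height hht h
    have h2 := h1.resolve_left (neg_ne_zero.2 h0)
    rw [map_neg] at hn h2
    exact ⟨⟨-n, by push_cast; linarith⟩, by linarith, fun _ => by linarith, fun _ => by linarith⟩

theorem exists_simple_inner_pos {x y : V} (hx : x ∈ AddSubmonoid.closure (Set.range Δ))
    (h : 0 < (⟪x, y⟫ : ℝ)) : ∃ i, 0 < (⟪Δ i, y⟫ : ℝ) := by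
  by_contra! hc
  have : ∀ x ∈ AddSubmonoid.closure (Set.range Δ), (⟪x, y⟫ : ℝ) ≤ 0 := by
    intro x hx
    induction hx using AddSubmonoid.closure_induction with
    | mem x hx => obtain ⟨i, rfl⟩ := hx; exact hc i
    | zero => simp
    | add x z _ _ hx hz => rw [inner_add_left]; linarith
  linarith [this x hx]

theorem pos_decomp (hR : IsSimplyLacedRootSystem R) (hb : IsBase R (Set.range Δ))
    {ht : V →ₗ[ℝ] ℝ} (hht : ∀ i, ht (Δ i) = 1) {α : V} (hα : α ∈ R) (pα : 0 < ht α) :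
    (∃ i, α = Δ i) ∨ ∃ β ∈ R, ∃ γ ∈ R, 0 < ht β ∧ 0 < ht γ ∧ α = β + γ := by
  obtain ⟨i, hi⟩ := exists_simple_inner_pos ((root_height hR hb hht hα).2.2.1 pα).2
    (show 0 < (⟪α, α⟫ : ℝ) by rw [hR.norm_two α hα]; norm_num)
  have hΔ : Δ i ∈ R := hb.1 ⟨i, rfl⟩
  rcases hR.inner_cases hΔ hα with h | h | h | h | h
  · exact Or.inl ⟨i, h.symm⟩
  · rw [h, inner_neg_left, hR.norm_two α hα] at hi; norm_num at hi
  · rw [h] at hi; norm_num at hi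
  · rw [h] at hi; norm_num at hi
  · right
    have hδ : α + -Δ i ∈ R := hR.add_mem_of_inner hα (hR.neg_mem hΔ) (by
      rw [inner_neg_right, real_inner_comm, h])
    refine ⟨α + -Δ i, hδ, Δ i, hΔ, ?_, by rw [hht]; norm_num, by abel⟩
    rcases lt_or_gt_of_ne (root_height hR hb hht hδ).2.1 with h1 | h1
    · have := (root_height hR hb hht hδ).2.2.2 h1
      rw [map_add, map_neg, hht] at this
      linarith
    · exact h1

theorem pos_induction (hR : IsSimplyLacedRootSystem R) (hb : IsBase R (Set.range Δ))
    {ht : V →ₗ[ℝ] ℝ} (hht : ∀ i, ht (Δ i) = 1) {P : V → Prop} (h1 : ∀ i, P (Δ i))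
    (h2 : ∀ β ∈ R, ∀ γ ∈ R, 0 < ht β → 0 < ht γ → β + γ ∈ R → P β → P γ → P (β + γ))
    {α : V} (hα : α ∈ R) (pα : 0 < ht α) : P α := by
  have main : ∀ n : ℕ, ∀ α ∈ R, 0 < ht α → ht α < n → P α := by
    intro n
    induction n with
    | zero => intro α _ p q; push_cast at q; linarith
    | succ n ih =>
      intro α hα pα hlt
      rcases pos_decomp hR hb hht hα pα with ⟨i, rfl⟩ | ⟨β, hβ, γ, hγ, pβ, pγ, rfl⟩
      · exact h1 i
      · have q1 := ((root_height hR hb hht hβ).2.2.1 pβ).1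
        have q2 := ((root_height hR hb hht hγ).2.2.1 pγ).1
        rw [map_add] at hlt
        push_cast at hlt
        exact h2 β hβ γ hγ pβ pγ hα (ih β hβ pβ (by linarith)) (ih γ hγ pγ (by linarith))
  obtain ⟨n, hn⟩ := exists_nat_gt (ht α)
  exact main n α hα pα hn

end Base

/-! ### The full normalized basis -/

section Full

variable {R : Finset V} {H : LieSubalgebra ℂ L} {χ : V → H → ℂ} {gsp : V → Submodule ℂ L}

theorem bracket_flip (hR : IsSimplyLacedRootSystem R)
    (hg : IsRootSpaceDecomposition R H χ gsp) {ε : V → V → ℂ} (hε : IsSignCocycle R ε)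
    {E : V → L} (hE : ∀ α ∈ R, E α ∈ gsp α)
    (hact : ∀ α ∈ R, ∀ β ∈ R, ⁅⁅E (-α), E α⁆, E β⁆ = ((⟪α, β⟫ : ℝ) : ℂ) • E β)
    {α β : V} (hα : α ∈ R) (hβ : β ∈ R) (hs : α + β ∈ R)
    (h : ⁅E α, E β⁆ = ε α β • E (α + β)) :
    ⁅E (-α), E (α + β)⁆ = ε (-α) (α + β) • E β := by
  have hin := hR.inner_of_add_mem hα hβ hs
  have e1 : E (α + β) = ε α β • ⁅E α, E β⁆ := by
    rw [h, smul_smul, hε.sq α hα β hβ, one_smul]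
  have e2 : ⁅E (-α), E β⁆ = 0 := by
    refine hg.bracket_eq_zero _ (hR.neg_mem hα) _ hβ ?_ ?_ _ (hE _ (hR.neg_mem hα)) _ (hE _ hβ)
    · intro h'
      have := hR.inner_of_add_mem (hR.neg_mem hα) hβ h'
      rw [inner_neg_left, hin] at this
      norm_num at this
    · intro h'
      have : α = β := by rw [← neg_eq_of_add_eq_zero_right h', neg_neg]
      rw [this, hR.norm_two β hβ] at hin
      norm_num at hin
  rw [e1, lie_smul, leibniz_lie, e2, lie_zero, add_zero, hact α hα β hβ, hin,
    hε.neg_left α hα _ hs, hε.add_right, hε.self α hα, smul_smul]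
  congr 1
  push_cast
  ring

/-- `[[E_{-β}, E_{-γ}], [E_β, E_γ]] = [E_{-β}, E_β] + [E_{-γ}, E_γ]`. -/
theorem coroot_add (hR : IsSimplyLacedRootSystem R)
    (hg : IsRootSpaceDecomposition R H χ gsp) {ε : V → V → ℂ} (hε : IsSignCocycle R ε)
    {E : V → L} (hE : ∀ α ∈ R, E α ∈ gsp α) {β γ : V} (hβ : β ∈ R) (hγ : γ ∈ R) (hs : β + γ ∈ R)
    (h1 : ⁅E β, E γ⁆ = ε β γ • E (β + γ)) (h2 : ⁅E (-β), E (-γ)⁆ = ε β γ • E (-(β + γ)))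
    (a1 : ∀ δ ∈ R, ⁅⁅E (-β), E β⁆, E δ⁆ = ((⟪β, δ⟫ : ℝ) : ℂ) • E δ)
    (a2 : ∀ δ ∈ R, ⁅⁅E (-γ), E γ⁆, E δ⁆ = ((⟪γ, δ⟫ : ℝ) : ℂ) • E δ) :
    ⁅E (-(β + γ)), E (β + γ)⁆ = ⁅E (-β), E β⁆ + ⁅E (-γ), E γ⁆ := by
  have hin := hR.inner_of_add_mem hβ hγ hs
  have zero : ∀ x ∈ R, ∀ y ∈ R, (⟪x, y⟫ : ℝ) = -1 → ⁅E (-x), E y⁆ = 0 := by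
    intro x hx y hy hxy
    refine hg.bracket_eq_zero _ (hR.neg_mem hx) _ hy ?_ ?_ _ (hE _ (hR.neg_mem hx)) _ (hE _ hy)
    · intro h'
      have := hR.inner_of_add_mem (hR.neg_mem hx) hy h'
      rw [inner_neg_left, hxy] at this
      norm_num at this
    · intro h'
      have : x = y := by rw [← neg_eq_of_add_eq_zero_right h', neg_neg]
      rw [this, hR.norm_two y hy] at hxy
      norm_num at hxy
  have hin' : (⟪γ, β⟫ : ℝ) = -1 := by rw [real_inner_comm, hin]
  have e1 : E (β + γ) = ε β γ • ⁅E β, E γ⁆ := by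
    rw [h1, smul_smul, hε.sq β hβ γ hγ, one_smul]
  have e2 : E (-(β + γ)) = ε β γ • ⁅E (-β), E (-γ)⁆ := by
    rw [h2, smul_smul, hε.sq β hβ γ hγ, one_smul]
  have c1 : ⁅E (-γ), ⁅E β, E γ⁆⁆ = E β := by
    rw [leibniz_lie, zero γ hγ β hβ hin', zero_lie, zero_add, ← lie_skew, a2 β hβ, hin']
    simp
  have c2 : ⁅E (-β), ⁅E β, E γ⁆⁆ = -E γ := by
    rw [leibniz_lie, zero β hβ γ hγ hin, lie_zero, add_zero, a1 γ hγ, hin]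
    simp
  rw [e1, e2, smul_lie, lie_smul, smul_smul, hε.sq β hβ γ hγ, one_smul, lie_lie, c1, c2, lie_neg,
    sub_neg_eq_add]

/-- Existence of the sign-normalized root basis. -/
theorem exists_full_basis (hR : IsSimplyLacedRootSystem R)
    (hg : IsRootSpaceDecomposition R H χ gsp) {ε : V → V → ℂ} (hε : IsSignCocycle R ε)
    {Δ : I → V} {e f h : I → L} (hgen : AreChevalleyGenerators R gsp Δ e f h)
    {ht : V →ₗ[ℝ] ℝ} (hht : ∀ i, ht (Δ i) = 1) :
    ∃ E : V → L, (∀ α ∈ R, E α ∈ gsp α ∧ E α ≠ 0) ∧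
      (∀ α ∈ R, ∀ β ∈ R, α + β ∈ R → ⁅E α, E β⁆ = ε α β • E (α + β)) ∧
      (∀ α ∈ R, ∀ β ∈ R, ⁅⁅E (-α), E α⁆, E β⁆ = ((⟪α, β⟫ : ℝ) : ℂ) • E β) ∧
      (∀ i, E (Δ i) = e i) ∧ (∀ i, E (-Δ i) = -f i) := by
  classical
  have hb := hgen.base
  have hΔ := hgen.base_mem
  -- prescribed values
  have hv : ∀ α ∈ R, ∃ v : L, (v ∈ gsp α ∧ v ≠ 0) ∧ (∀ i, α = Δ i → v = e i) ∧
      (∀ i, α = -Δ i → v = -f i) := by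
    intro α hα
    have hcross : ∀ i j, Δ i ≠ -Δ j := by
      intro i j hij
      have := congrArg ht hij
      rw [map_neg, hht, hht] at this
      norm_num at this
    by_cases c1 : ∃ i, α = Δ i
    · obtain ⟨i, rfl⟩ := c1
      exact ⟨e i, ⟨hgen.e_mem i, hgen.e_ne i⟩, fun j hj => by rw [hgen.base_inj hj],
        fun j hj => absurd hj (hcross i j)⟩
    by_cases c2 : ∃ i, α = -Δ i
    · obtain ⟨i, rfl⟩ := c2
      exact ⟨-f i, ⟨Submodule.neg_mem _ (hgen.f_mem i), neg_ne_zero.2 (hgen.f_ne i)⟩,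
        fun j hj => absurd hj.symm (hcross j i), fun j hj => by rw [hgen.base_inj (neg_injective hj)]⟩
    · have : Nontrivial (gsp α) := Module.nontrivial_of_finrank_pos (R := ℂ)
        (by rw [hg.finrank_eq_one α hα]; norm_num)
      obtain ⟨v, hv⟩ := exists_ne (0 : gsp α)
      exact ⟨v, ⟨v.2, by simpa using hv⟩, fun i hi => absurd ⟨i, hi⟩ c1,
        fun i hi => absurd ⟨i, hi⟩ c2⟩
  choose! x hx hxe hxf using hv
  have hintg : ∀ α ∈ R, ∃ n : ℤ, ht α = n := fun α hα => (root_height hR hb hht hα).1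
  have hne : ∀ α ∈ R, ht α ≠ 0 := fun α hα => (root_height hR hb hht hα).2.1
  obtain ⟨E₁, p1, p2, p3⟩ := exists_pos_basis hR hg hε ht hintg hne x hx
  obtain ⟨E₂, q1, q2, q3⟩ := exists_pos_basis hR hg hε (-ht)
    (fun α hα => by obtain ⟨n, hn⟩ := hintg α hα; exact ⟨-n, by simp [hn]⟩)
    (fun α hα => by simpa using hne α hα) x hx
  simp only [LinearMap.neg_apply, Left.neg_pos_iff] at q1 q2 q3
  let E : V → L := fun α => if 0 < ht α then E₁ α else E₂ α
  have Epos : ∀ α, 0 < ht α → E α = E₁ α := fun α h => if_pos h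
  have Eneg : ∀ α, ht α < 0 → E α = E₂ α := fun α h => if_neg (not_lt.2 h.le)
  have hE : ∀ α ∈ R, E α ∈ gsp α ∧ E α ≠ 0 := by
    intro α hα
    rcases lt_or_gt_of_ne (hne α hα) with h | h
    · rw [Eneg α h]; exact q1 α hα h
    · rw [Epos α h]; exact p1 α hα h
  have hE' : ∀ α ∈ R, E α ∈ gsp α := fun α hα => (hE α hα).1
  have brP : ∀ β ∈ R, ∀ γ ∈ R, 0 < ht β → 0 < ht γ → β + γ ∈ R →
      ⁅E β, E γ⁆ = ε β γ • E (β + γ) := by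
    intro β hβ γ hγ a b c
    rw [Epos β a, Epos γ b, Epos _ (by rw [map_add]; linarith)]
    exact p2 β hβ γ hγ a b c
  have brN : ∀ β ∈ R, ∀ γ ∈ R, ht β < 0 → ht γ < 0 → β + γ ∈ R →
      ⁅E β, E γ⁆ = ε β γ • E (β + γ) := by
    intro β hβ γ hγ a b c
    rw [Eneg β a, Eneg γ b, Eneg _ (by rw [map_add]; linarith)]
    exact q2 β hβ γ hγ a b c
  have brN' : ∀ β ∈ R, ∀ γ ∈ R, 0 < ht β → 0 < ht γ → β + γ ∈ R →
      ⁅E (-β), E (-γ)⁆ = ε β γ • E (-(β + γ)) := by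
    intro β hβ γ hγ a b c
    have := brN (-β) (hR.neg_mem hβ) (-γ) (hR.neg_mem hγ) (by simpa using a) (by simpa using b)
      (by rw [← neg_add]; exact hR.neg_mem c)
    rwa [hε.neg_left β hβ _ (hR.neg_mem hγ), hε.neg_right β hβ γ hγ, ← neg_add] at this
  have hEe : ∀ i, E (Δ i) = e i := by
    intro i
    rw [Epos _ (by rw [hht]; norm_num), p3 _ (hΔ i) (by rw [hht]; norm_num)]
    · exact hxe _ (hΔ i) i rfl
    · intro β hβ γ hγ a b hab
      have h1 := ((root_height hR hb hht hβ).2.2.1 a).1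
      have h2 := ((root_height hR hb hht hγ).2.2.1 b).1
      have := congrArg ht hab
      rw [map_add, hht] at this
      linarith
  have hEf : ∀ i, E (-Δ i) = -f i := by
    intro i
    rw [Eneg _ (by rw [map_neg, hht]; norm_num),
      q3 _ (hR.neg_mem (hΔ i)) (by rw [map_neg, hht]; norm_num)]
    · exact hxf _ (hR.neg_mem (hΔ i)) i rfl
    · intro β hβ γ hγ a b hab
      have h1 := (root_height hR hb hht hβ).2.2.2 a
      have h2 := (root_height hR hb hht hγ).2.2.2 b
      have := congrArg ht hab
      rw [map_add, map_neg, hht] at this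
      linarith
  have εne : ∀ β ∈ R, ∀ γ ∈ R, ε β γ ≠ 0 := by
    intro β hβ γ hγ h0
    have := hε.sq β hβ γ hγ
    rw [h0] at this
    simp at this
  -- the action of `h i`
  have hder : ∀ (k x y z : L) (c a b : ℂ), c ≠ 0 → ⁅x, y⁆ = c • z → ⁅k, x⁆ = a • x →
      ⁅k, y⁆ = b • y → ⁅k, z⁆ = (a + b) • z := by
    intro k x y z c a b hc hxy h1 h2
    have : c • ⁅k, z⁆ = c • ((a + b) • z) := by
      rw [← lie_smul, ← hxy, leibniz_lie, h1, h2, smul_lie, lie_smul, hxy]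
      module
    exact smul_right_injective _ hc this
  have hactP : ∀ i, ∀ β ∈ R, 0 < ht β → ⁅h i, E β⁆ = ((⟪Δ i, β⟫ : ℝ) : ℂ) • E β := by
    intro i β hβ pβ
    refine pos_induction hR hb hht (P := fun β => ⁅h i, E β⁆ = ((⟪Δ i, β⟫ : ℝ) : ℂ) • E β)
      ?_ ?_ hβ pβ
    · intro j
      rw [hEe j]
      exact hgen.lie_h_e i j
    · intro β hβ γ hγ a b hs h1 h2
      rw [inner_add_right, Complex.ofReal_add]
      exact hder _ _ _ _ _ _ _ (εne β hβ γ hγ) (brP β hβ γ hγ a b hs) h1 h2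
  have hactN : ∀ i, ∀ β ∈ R, 0 < ht β → ⁅h i, E (-β)⁆ = ((⟪Δ i, -β⟫ : ℝ) : ℂ) • E (-β) := by
    intro i β hβ pβ
    refine pos_induction hR hb hht (P := fun β => ⁅h i, E (-β)⁆ = ((⟪Δ i, -β⟫ : ℝ) : ℂ) • E (-β))
      ?_ ?_ hβ pβ
    · intro j
      rw [hEf j, lie_neg, hgen.lie_h_f i j, inner_neg_right]
      push_cast
      module
    · intro β hβ γ hγ a b hs h1 h2
      rw [neg_add, inner_add_right, Complex.ofReal_add]
      refine hder _ _ _ _ _ _ _ (εne β hβ γ hγ) ?_ h1 h2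
      rw [← neg_add]
      exact brN' β hβ γ hγ a b hs
  have hacth : ∀ i, ∀ β ∈ R, ⁅h i, E β⁆ = ((⟪Δ i, β⟫ : ℝ) : ℂ) • E β := by
    intro i β hβ
    rcases lt_or_gt_of_ne (hne β hβ) with h | h
    · have := hactN i (-β) (hR.neg_mem hβ) (by simpa using h)
      rwa [neg_neg] at this
    · exact hactP i β hβ h
  have hactpos : ∀ α ∈ R, 0 < ht α →
      ∀ β ∈ R, ⁅⁅E (-α), E α⁆, E β⁆ = ((⟪α, β⟫ : ℝ) : ℂ) • E β := by
    intro α hα pα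
    refine pos_induction hR hb hht
      (P := fun α => ∀ β ∈ R, ⁅⁅E (-α), E α⁆, E β⁆ = ((⟪α, β⟫ : ℝ) : ℂ) • E β) ?_ ?_ hα pα
    · intro i β hβ
      rw [hEe, hEf, neg_lie, lie_skew, ← hgen.h_eq]
      exact hacth i β hβ
    · intro β hβ γ hγ a b hs h1 h2 δ hδ
      rw [coroot_add hR hg hε hE' hβ hγ hs (brP β hβ γ hγ a b hs) (brN' β hβ γ hγ a b hs) h1 h2,
        add_lie, h1 δ hδ, h2 δ hδ, inner_add_left]
      push_cast
      module
  have hact : ∀ α ∈ R, ∀ β ∈ R, ⁅⁅E (-α), E α⁆, E β⁆ = ((⟪α, β⟫ : ℝ) : ℂ) • E β := by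
    intro α hα β hβ
    rcases lt_or_gt_of_ne (hne α hα) with h | h
    · have := hactpos (-α) (hR.neg_mem hα) (by simpa using h) β hβ
      rw [neg_neg, inner_neg_left, ← lie_skew (E α) (E (-α)), neg_lie] at this
      rw [neg_eq_iff_eq_neg.1 this]
      push_cast
      module
    · exact hactpos α hα h β hβ
  have flip : ∀ α ∈ R, ∀ β ∈ R, α + β ∈ R → ⁅E α, E β⁆ = ε α β • E (α + β) →
      ⁅E (-α), E (α + β)⁆ = ε (-α) (α + β) • E β := fun α hα β hβ hs hh =>
    bracket_flip hR hg hε hE' hact hα hβ hs hh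
  have swap : ∀ α ∈ R, ∀ β ∈ R, α + β ∈ R → ⁅E α, E β⁆ = ε α β • E (α + β) →
      ⁅E β, E α⁆ = ε β α • E (β + α) := by
    intro α hα β hβ hs hh
    rw [← lie_skew, hh, hε.skew α hα β hβ hs, add_comm β α, neg_smul]
  -- one positive and one negative root
  have mixed : ∀ α ∈ R, ∀ β ∈ R, 0 < ht α → ht β < 0 → α + β ∈ R →
      ⁅E α, E β⁆ = ε α β • E (α + β) := by
    intro α hα β hβ pα nβ hs
    rcases lt_or_gt_of_ne (hne _ hs) with hl | hl
    · have e1 : -α + (α + β) = β := by abel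
      have h1 := brN (-α) (hR.neg_mem hα) (α + β) hs (by simpa using pα) hl (by rwa [e1])
      have h2 := flip (-α) (hR.neg_mem hα) (α + β) hs (by rwa [e1]) h1
      rwa [e1, neg_neg] at h2
    · have e1 : -β + (α + β) = α := by abel
      have h1 := brP (-β) (hR.neg_mem hβ) (α + β) hs (by simpa using nβ) hl (by rwa [e1])
      have h2 := flip (-β) (hR.neg_mem hβ) (α + β) hs (by rwa [e1]) h1
      rw [e1, neg_neg] at h2
      refine swap β hβ α hα (by rwa [add_comm]) ?_
      rw [add_comm β α]
      exact h2
  refine ⟨E, hE, ?_, hact, hEe, hEf⟩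
  intro α hα β hβ hs
  rcases lt_or_gt_of_ne (hne α hα) with h1 | h1 <;> rcases lt_or_gt_of_ne (hne β hβ) with h2 | h2
  · exact brN α hα β hβ h1 h2 hs
  · exact swap β hβ α hα (by rwa [add_comm]) (mixed β hβ α hα h2 h1 (by rwa [add_comm]))
  · exact mixed α hα β hβ h1 h2 hs
  · exact brP α hα β hβ h1 h2 hs

end Full

/-! ### Exponentials and the automorphisms `τᵢ` -/

section Exp

theorem pow_finrank_eq_zero_of_nilpotent {a : Module.End ℂ L} (ha : IsNilpotent a) :
    a ^ Module.finrank ℂ L = 0 := by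
  have h := LinearMap.aeval_self_charpoly a
  rw [IsNilpotent.charpoly_eq_X_pow_finrank ha] at h
  simpa using h

theorem expEnd_apply_of_cube {a : Module.End ℂ L} (ha : IsNilpotent a) {x : L}
    (hx : a (a (a x)) = 0) : expEnd a x = x + a x + (2 : ℂ)⁻¹ • a (a x) := by
  have h0 := pow_finrank_eq_zero_of_nilpotent ha
  set N := Module.finrank ℂ L with hN
  have h1 : expEnd a = ∑ n ∈ Finset.range (N + 3), (n.factorial : ℂ)⁻¹ • a ^ n := by
    rw [expEnd, ← hN, show N + 3 = N + 1 + 1 + 1 from rfl, Finset.sum_range_succ _ (N + 1 + 1),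
      Finset.sum_range_succ _ (N + 1), pow_succ _ (N + 1), pow_succ _ N, h0]
    simp
  have h2 : ∀ k, (a ^ (3 + k)) x = 0 := by
    intro k
    rw [add_comm, pow_add, Module.End.mul_apply, show (a ^ 3) x = a (a (a x)) by
      simp [pow_succ, Module.End.mul_apply], hx, map_zero]
  rw [h1, LinearMap.sum_apply, add_comm N 3, Finset.sum_range_add]
  simp only [LinearMap.smul_apply, h2, smul_zero, Finset.sum_const_zero, add_zero]
  simp [Finset.sum_range_succ, pow_succ, Module.End.mul_apply]

theorem expEnd_ad_lie {y : L} (hy : IsNilpotent (LieAlgebra.ad ℂ L y)) (u v : L) :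
    expEnd (LieAlgebra.ad ℂ L y) ⁅u, v⁆ =
      ⁅expEnd (LieAlgebra.ad ℂ L y) u, expEnd (LieAlgebra.ad ℂ L y) v⁆ := by
  let : Module ℚ L := Module.compHom L (algebraMap ℚ ℂ)
  have hsm : ∀ (q : ℚ) (z : L), q • z = (q : ℂ) • z := fun q z => rfl
  let _i := LieRing.toNonUnitalNonAssocRing L
  have : SMulCommClass ℂ L L := LieAlgebra.smulCommClass ℂ L
  have : IsScalarTower ℂ L L := LieAlgebra.isScalarTower ℂ L
  have heq : ∀ z, expEnd (LieAlgebra.ad ℂ L y) z = IsNilpotent.exp (LieAlgebra.ad ℂ L y) z := by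
    intro z
    have h0 := pow_finrank_eq_zero_of_nilpotent hy
    have h1 : (LieAlgebra.ad ℂ L y) ^ (Module.finrank ℂ L + 1) = 0 := by
      rw [pow_succ, h0, zero_mul]
    rw [IsNilpotent.exp_eq_sum h1, expEnd, LinearMap.sum_apply, LinearMap.sum_apply]
    refine Finset.sum_congr rfl fun n _ => ?_
    rw [LinearMap.smul_apply, LinearMap.smul_apply, hsm]
    push_cast
    rfl
  rw [heq, heq, heq]
  refine Module.End.exp_mul_of_derivation ℂ L (LieAlgebra.ad ℂ L y) ?_ hy u v
  intro a b
  change ⁅y, ⁅a, b⁆⁆ = ⁅a, ⁅y, b⁆⁆ + ⁅⁅y, a⁆, b⁆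
  rw [leibniz_lie, add_comm]

end Exp

section Tau

variable {R : Finset V} {H : LieSubalgebra ℂ L} {χ : V → H → ℂ} {gsp : V → Submodule ℂ L}
  {Δ : I → V} {e f h : I → L}

theorem neg_ad_nilpotent {y : L} (hy : IsNilpotent (LieAlgebra.ad ℂ L y)) :
    IsNilpotent (LieAlgebra.ad ℂ L (-y)) := by
  rw [map_neg]; exact hy.neg

theorem chevalleyTau_lie (hgen : AreChevalleyGenerators R gsp Δ e f h) (i : I) (u v : L) :
    chevalleyTau e f i ⁅u, v⁆ = ⁅chevalleyTau e f i u, chevalleyTau e f i v⁆ := by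
  have h1 := hgen.ad_e_nilpotent i
  have h2 := neg_ad_nilpotent (hgen.ad_f_nilpotent i)
  simp only [chevalleyTau, ← map_neg, Module.End.mul_apply]
  rw [expEnd_ad_lie h1, expEnd_ad_lie h2, expEnd_ad_lie h1]

theorem chevalleyTau_apply (e f : I → L) (i : I) (x : L) :
    chevalleyTau e f i x = expEnd (LieAlgebra.ad ℂ L (e i))
      (expEnd (LieAlgebra.ad ℂ L (-f i)) (expEnd (LieAlgebra.ad ℂ L (e i)) x)) := by
  simp only [chevalleyTau, ← map_neg, Module.End.mul_apply]

theorem expEnd_ad_apply {y : L} (hy : IsNilpotent (LieAlgebra.ad ℂ L y)) {x : L}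
    (hx : ⁅y, ⁅y, ⁅y, x⁆⁆⁆ = 0) :
    expEnd (LieAlgebra.ad ℂ L y) x = x + ⁅y, x⁆ + (2 : ℂ)⁻¹ • ⁅y, ⁅y, x⁆⁆ :=
  expEnd_apply_of_cube hy hx

theorem expEnd_ad_apply₁ {y : L} (hy : IsNilpotent (LieAlgebra.ad ℂ L y)) {x : L}
    (hx : ⁅y, ⁅y, x⁆⁆ = 0) :
    expEnd (LieAlgebra.ad ℂ L y) x = x + ⁅y, x⁆ := by
  rw [expEnd_ad_apply hy (by rw [hx, lie_zero]), hx, smul_zero, add_zero]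

theorem expEnd_ad_apply₀ {y : L} (hy : IsNilpotent (LieAlgebra.ad ℂ L y)) {x : L}
    (hx : ⁅y, x⁆ = 0) :
    expEnd (LieAlgebra.ad ℂ L y) x = x := by
  rw [expEnd_ad_apply₁ hy (by rw [hx, lie_zero]), hx, add_zero]

theorem lie_zero_of_inner_nonneg (hR : IsSimplyLacedRootSystem R)
    (hg : IsRootSpaceDecomposition R H χ gsp) {α β : V} (hα : α ∈ R) (hβ : β ∈ R)
    (hin : 0 ≤ (⟪α, β⟫ : ℝ)) {x y : L} (hx : x ∈ gsp α) (hy : y ∈ gsp β) : ⁅x, y⁆ = 0 := by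
  refine hg.bracket_eq_zero α hα β hβ ?_ ?_ x hx y hy
  · intro h
    have := hR.inner_of_add_mem hα hβ h
    linarith
  · intro h
    rw [eq_neg_of_add_eq_zero_left h, inner_neg_left, hR.norm_two β hβ] at hin
    norm_num at hin

theorem chevalleyTau_e (hR : IsSimplyLacedRootSystem R)
    (hgen : AreChevalleyGenerators R gsp Δ e f h) (i : I) :
    chevalleyTau e f i (e i) = -f i := by
  have n1 := hgen.ad_e_nilpotent i
  have n2 := neg_ad_nilpotent (hgen.ad_f_nilpotent i)
  have hef : ⁅e i, f i⁆ = h i := (hgen.h_eq i).symm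
  have hfe : ⁅f i, e i⁆ = -h i := by rw [← lie_skew, hef]
  have hhe : ⁅e i, h i⁆ = -(2 : ℂ) • e i := by
    rw [← lie_skew, hgen.lie_h_e, hR.norm_two _ (hgen.base_mem i)]; push_cast; module
  have hhf : ⁅f i, h i⁆ = (2 : ℂ) • f i := by
    rw [← lie_skew, hgen.lie_h_f, hR.norm_two _ (hgen.base_mem i)]; push_cast; module
  rw [chevalleyTau_apply, expEnd_ad_apply₀ n1 (lie_self _), expEnd_ad_apply n2, map_add, map_add]
  · simp only [neg_lie, hfe, hhf, neg_neg, lie_neg, lie_smul, map_smul, map_neg, smul_neg]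
    rw [expEnd_ad_apply₀ n1 (lie_self _), expEnd_ad_apply₁ n1, expEnd_ad_apply n1]
    · simp only [hef, hhe, lie_smul, lie_self]
      module
    · simp [hef, hhe]
    · simp [hhe]
  · simp [hfe, hhf]

theorem chevalleyTau_f (hR : IsSimplyLacedRootSystem R)
    (hgen : AreChevalleyGenerators R gsp Δ e f h) (i : I) :
    chevalleyTau e f i (f i) = -e i := by
  have n1 := hgen.ad_e_nilpotent i
  have n2 := neg_ad_nilpotent (hgen.ad_f_nilpotent i)
  have hef : ⁅e i, f i⁆ = h i := (hgen.h_eq i).symm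
  have hfe : ⁅f i, e i⁆ = -h i := by rw [← lie_skew, hef]
  have hhe : ⁅e i, h i⁆ = -(2 : ℂ) • e i := by
    rw [← lie_skew, hgen.lie_h_e, hR.norm_two _ (hgen.base_mem i)]; push_cast; module
  have hhf : ⁅f i, h i⁆ = (2 : ℂ) • f i := by
    rw [← lie_skew, hgen.lie_h_f, hR.norm_two _ (hgen.base_mem i)]; push_cast; module
  have k1 : expEnd (LieAlgebra.ad ℂ L (e i)) (f i) = f i + h i - e i := by
    rw [expEnd_ad_apply n1 (by simp [hef, hhe]), hef, hhe]
    module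
  have k2 : expEnd (LieAlgebra.ad ℂ L (-f i)) (f i) = f i := expEnd_ad_apply₀ n2 (by simp)
  have k3 : expEnd (LieAlgebra.ad ℂ L (-f i)) (h i) = h i - (2 : ℂ) • f i := by
    rw [expEnd_ad_apply₁ n2 (by simp only [neg_lie, lie_neg, hhf, lie_smul, lie_self]; simp),
      neg_lie, hhf]
    module
  have k4 : expEnd (LieAlgebra.ad ℂ L (-f i)) (e i) = e i + h i - f i := by
    rw [expEnd_ad_apply n2
      (by simp only [neg_lie, lie_neg, hfe, hhf, lie_smul, lie_self, neg_neg]; simp)]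
    simp only [neg_lie, hfe, neg_neg, hhf]
    module
  rw [chevalleyTau_apply, k1, map_sub (expEnd (LieAlgebra.ad ℂ L (-f i))),
    map_add (expEnd (LieAlgebra.ad ℂ L (-f i))), k2, k3, k4,
    show f i + (h i - (2 : ℂ) • f i) - (e i + h i - f i) = -e i by module, map_neg,
    expEnd_ad_apply₀ n1 (lie_self _)]

theorem chevalleyTau_mem (hR : IsSimplyLacedRootSystem R)
    (hg : IsRootSpaceDecomposition R H χ gsp)
    (hgen : AreChevalleyGenerators R gsp Δ e f h) (i : I)
    (hh : ∀ β ∈ R, ∀ x ∈ gsp β, ⁅h i, x⁆ = ((⟪Δ i, β⟫ : ℝ) : ℂ) • x)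
    {β : V} (hβ : β ∈ R) {x : L} (hx : x ∈ gsp β) :
    chevalleyTau e f i x ∈ gsp (reflLM (Δ i) β) := by
  have hα := hgen.base_mem i
  have hα' := hR.neg_mem hα
  have n1 := hgen.ad_e_nilpotent i
  have n2 := neg_ad_nilpotent (hgen.ad_f_nilpotent i)
  have hef : ⁅e i, f i⁆ = h i := (hgen.h_eq i).symm
  have hfe : ⁅f i, e i⁆ = -h i := by rw [← lie_skew, hef]
  have he := hgen.e_mem i
  have hf := hgen.f_mem i
  have hfn : -f i ∈ gsp (-Δ i) := Submodule.neg_mem _ hf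
  have nα := hR.norm_two _ hα
  rcases hR.inner_cases hα hβ with hc | hc | hc | hc | hc
  · subst hc
    obtain ⟨c, rfl⟩ := exists_smul_of_mem hg hα he (hgen.e_ne i) hx
    rw [map_smul, chevalleyTau_e hR hgen, reflLM_apply', nα,
      show Δ i - (2 : ℝ) • Δ i = -Δ i by module]
    exact Submodule.smul_mem _ _ hfn
  · obtain rfl : β = -Δ i := by rw [hc, neg_neg]
    obtain ⟨c, rfl⟩ := exists_smul_of_mem hg hα' hf (hgen.f_ne i) hx
    rw [map_smul, chevalleyTau_f hR hgen, reflLM_apply', inner_neg_right, nα,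
      show -Δ i - (-2 : ℝ) • Δ i = Δ i by module]
    exact Submodule.smul_mem _ _ (Submodule.neg_mem _ he)
  · have hs := hR.add_mem_of_inner hα hβ hc
    have m1 := hg.bracket_mem _ hα _ hβ hs _ he _ hx
    have z1 : ⁅f i, x⁆ = 0 := lie_zero_of_inner_nonneg hR hg hα' hβ
      (by rw [inner_neg_left, hc]; norm_num) hf hx
    have z2 : ⁅e i, ⁅e i, x⁆⁆ = 0 := lie_zero_of_inner_nonneg hR hg hα hs
      (by rw [inner_add_right, hc, nα]; norm_num) he m1
    have z3 : ⁅f i, ⁅e i, x⁆⁆ = x := by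
      rw [leibniz_lie, z1, lie_zero, add_zero, hfe, neg_lie, hh β hβ x hx, hc]; simp
    rw [chevalleyTau_apply, expEnd_ad_apply₁ n1 z2, map_add, expEnd_ad_apply₀ n2 (by simp [z1]),
      expEnd_ad_apply₁ n2 (by simp [z1, z3]), neg_lie, z3,
      show x + (⁅e i, x⁆ + -x) = ⁅e i, x⁆ by abel, expEnd_ad_apply₀ n1 z2, reflLM_apply', hc,
      show β - (-1 : ℝ) • Δ i = Δ i + β by module]
    exact m1
  · have z1 : ⁅f i, x⁆ = 0 := lie_zero_of_inner_nonneg hR hg hα' hβ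
      (by rw [inner_neg_left, hc]; norm_num) hf hx
    have z2 : ⁅e i, x⁆ = 0 := lie_zero_of_inner_nonneg hR hg hα hβ hc.ge he hx
    rw [chevalleyTau_apply, expEnd_ad_apply₀ n1 z2, expEnd_ad_apply₀ n2 (by simp [z1]),
      expEnd_ad_apply₀ n1 z2, reflLM_apply', hc, zero_smul, sub_zero]
    exact hx
  · have hs := hR.add_mem_of_inner hα' hβ (by rw [inner_neg_left, hc])
    have m1 := hg.bracket_mem _ hα' _ hβ hs _ hf _ hx
    have z1 : ⁅e i, x⁆ = 0 := lie_zero_of_inner_nonneg hR hg hα hβ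
      (by rw [hc]; norm_num) he hx
    have z2 : ⁅f i, ⁅f i, x⁆⁆ = 0 := lie_zero_of_inner_nonneg hR hg hα' hs
      (by rw [inner_add_right, inner_neg_neg, inner_neg_left, hc, nα]; norm_num) hf m1
    have z3 : ⁅e i, ⁅f i, x⁆⁆ = x := by
      rw [leibniz_lie, z1, lie_zero, add_zero, hef, hh β hβ x hx, hc]; simp
    rw [chevalleyTau_apply, expEnd_ad_apply₀ n1 z1, expEnd_ad_apply₁ n2 (by simp only [neg_lie, lie_neg, z2, neg_zero]),
      map_add, expEnd_ad_apply₀ n1 z1, 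
      expEnd_ad_apply₁ n1 (by simp only [neg_lie, lie_neg, z3, z1, neg_zero]), neg_lie, lie_neg, z3,
      show x + (-⁅f i, x⁆ + -x) = -⁅f i, x⁆ by abel, reflLM_apply', hc,
      show β - (1 : ℝ) • Δ i = -Δ i + β by module]
    exact Submodule.neg_mem _ m1

end Tau

/-! ### The Coxeter element and integrality of `⟨·, ·⟩` -/

section Coxeter

variable {R : Finset V} {Δ : I → V}

theorem reflLM_isometry {α : V} (hα : (⟪α, α⟫ : ℝ) = 2) (x y : V) :
    (⟪reflLM α x, reflLM α y⟫ : ℝ) = ⟪x, y⟫ := by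
  rw [reflLM_apply', reflLM_apply', inner_sub_left, inner_sub_right, inner_sub_right,
    inner_smul_left, inner_smul_right, inner_smul_left, inner_smul_right, hα,
    real_inner_comm α x]
  simp only [conj_trivial]
  ring

theorem prod_isometry (hR : IsSimplyLacedRootSystem R) (hΔ : ∀ i, Δ i ∈ R) (p : List I)
    (x y : V) :
    (⟪(p.map fun i => reflLM (Δ i)).prod x, (p.map fun i => reflLM (Δ i)).prod y⟫ : ℝ)
      = ⟪x, y⟫ := by
  induction p with
  | nil => simp
  | cons a p ih =>
    simp only [List.map_cons, List.prod_cons, Module.End.mul_apply]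
    rw [reflLM_isometry (hR.norm_two _ (hΔ a)), ih]

theorem reflProd_mem (hR : IsSimplyLacedRootSystem R) (hΔ : ∀ i, Δ i ∈ R) (p : List I)
    {x : V} (hx : x ∈ R) : (p.map fun i => reflLM (Δ i)).prod x ∈ R := by
  induction p with
  | nil => simpa using hx
  | cons a p ih =>
    simp only [List.map_cons, List.prod_cons, Module.End.mul_apply]
    exact hR.reflect_mem _ (hΔ a) _ ih

theorem prod_fix (p : List I) {v : V} (hv : ∀ i ∈ p, (⟪Δ i, v⟫ : ℝ) = 0) :
    (p.map fun i => reflLM (Δ i)).prod v = v := by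
  induction p with
  | nil => simp
  | cons a p ih =>
    simp only [List.map_cons, List.prod_cons, Module.End.mul_apply]
    rw [ih fun i hi => hv i (List.mem_cons_of_mem _ hi), reflLM_apply', hv a (by simp)]
    simp

theorem prod_sub_mem (hR : IsSimplyLacedRootSystem R) (hΔ : ∀ i, Δ i ∈ R) (G : AddSubgroup V)
    (p : List I) (hp : ∀ i ∈ p, Δ i ∈ G) {v : V} (hv : ∀ i, ∃ n : ℤ, (⟪Δ i, v⟫ : ℝ) = n) :
    (∀ i, ∃ n : ℤ, (⟪Δ i, (p.map fun i => reflLM (Δ i)).prod v⟫ : ℝ) = n) ∧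
      (p.map fun i => reflLM (Δ i)).prod v - v ∈ G := by
  induction p with
  | nil => simpa using hv
  | cons a p ih =>
    obtain ⟨h1, h2⟩ := ih fun i hi => hp i (List.mem_cons_of_mem _ hi)
    simp only [List.map_cons, List.prod_cons, Module.End.mul_apply]
    set w := (p.map fun i => reflLM (Δ i)).prod v
    obtain ⟨m, hm⟩ := h1 a
    rw [reflLM_apply', hm]
    constructor
    · intro i
      obtain ⟨n, hn⟩ := h1 i
      obtain ⟨k, hk⟩ := hR.inner_int _ (hΔ i) _ (hΔ a)
      refine ⟨n - m * k, ?_⟩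
      rw [inner_sub_right, inner_smul_right, hn, hk]
      push_cast
      ring
    · have e1 : w - (m : ℝ) • Δ a - v = (w - v) - m • Δ a := by
        rw [Int.cast_smul_eq_zsmul]; abel
      rw [e1]
      exact G.sub_mem h2 (G.zsmul_mem (hp a (by simp)) m)

theorem exists_dual_family (b : Module.Basis I ℝ V) (hb : ∀ i, b i = Δ i) (j : I) :
    ∃ ω : V, ∀ i, (⟪Δ i, ω⟫ : ℝ) = if i = j then 1 else 0 := by
  refine ⟨(InnerProductSpace.toDual ℝ V).symm (LinearMap.toContinuousLinearMap (b.coord j)), ?_⟩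
  intro i
  rw [real_inner_comm, InnerProductSpace.toDual_symm_apply, ← hb i]
  simp [Finsupp.single_apply]

theorem simple_integral (hR : IsSimplyLacedRootSystem R) (hΔ : ∀ i, Δ i ∈ R)
    (b : Module.Basis I ℝ V) (hb : ∀ i, b i = Δ i) {C D : V →ₗ[ℝ] V} {l : List I}
    (hl_nodup : l.Nodup) (hC : C = ((l.map fun i => reflLM (Δ i)).prod : V →ₗ[ℝ] V))
    (hD₁ : D * ((1 : V →ₗ[ℝ] V) - C) = 1) (G : AddSubgroup V)
    (hG : ∀ x, x ∈ G ↔ ∀ i, ∃ n : ℤ, (⟪D x, Δ i⟫ : ℝ) = n) :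
    ∀ p q : List I, l = p ++ q → ∀ i ∈ p, Δ i ∈ G := by
  intro p
  induction p using List.reverseRecOn with
  | nil => intro q _ i hi; simp at hi
  | append_singleton p j ih =>
    intro q hq
    have hq' : l = p ++ (j :: q) := by simpa using hq
    have ihp := ih (j :: q) hq'
    obtain ⟨ω, hω⟩ := exists_dual_family b hb j
    have hnd : (p ++ (j :: q)).Nodup := hq' ▸ hl_nodup
    have hjp : j ∉ p := by
      intro hj
      exact (List.nodup_append.1 hnd).2.2 j hj j (by simp) rfl
    have hjq : j ∉ q := (List.nodup_cons.1 (List.nodup_append.1 hnd).2.1).1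
    have fixp : (p.map fun i => reflLM (Δ i)).prod ω = ω := prod_fix p fun i hi => by
      rw [hω, if_neg]; rintro rfl; exact hjp hi
    have fixq : (q.map fun i => reflLM (Δ i)).prod ω = ω := prod_fix q fun i hi => by
      rw [hω, if_neg]; rintro rfl; exact hjq hi
    have hCω : ω - C ω = (p.map fun i => reflLM (Δ i)).prod (Δ j) := by
      rw [hC, hq', List.map_append, List.prod_append, List.map_cons, List.prod_cons,
        Module.End.mul_apply, Module.End.mul_apply, fixq, reflLM_apply', hω, if_pos rfl, one_smul,
        map_sub, fixp]
      abel
    have hDω : D ((p.map fun i => reflLM (Δ i)).prod (Δ j)) = ω := by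
      rw [← hCω]
      have := LinearMap.congr_fun hD₁ ω
      simpa [Module.End.mul_apply] using this
    have m1 : (p.map fun i => reflLM (Δ i)).prod (Δ j) ∈ G := by
      rw [hG]
      intro i
      rw [hDω, real_inner_comm, hω]
      by_cases h : i = j
      · exact ⟨1, by simp [h]⟩
      · exact ⟨0, by simp [h]⟩
    have m2 := (prod_sub_mem hR hΔ G p ihp (v := Δ j)
      (fun i => hR.inner_int _ (hΔ i) _ (hΔ j))).2
    have m3 : Δ j ∈ G := by
      have := G.sub_mem m1 m2
      rwa [sub_sub_cancel] at this
    intro i hi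
    rcases List.mem_append.1 hi with h | h
    · exact ihp i h
    · rw [List.mem_singleton.1 h]; exact m3

theorem root_mem_of_simple {G : AddSubgroup V} (hb : IsBase R (Set.range Δ))
    (hG : ∀ i, Δ i ∈ G) {α : V} (hα : α ∈ R) : α ∈ G := by
  have hle : AddSubmonoid.closure (Set.range Δ) ≤ G.toAddSubmonoid :=
    (AddSubmonoid.closure_le).2 (by rintro _ ⟨i, rfl⟩; exact hG i)
  rcases hb.2.2.2 α hα with h | h
  · exact hle h
  · exact G.neg_mem_iff.1 (hle h)

theorem pairing_integral (hR : IsSimplyLacedRootSystem R) (hΔ : ∀ i, Δ i ∈ R)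
    (hbase : IsBase R (Set.range Δ))
    (b : Module.Basis I ℝ V) (hb : ∀ i, b i = Δ i) {C D : V →ₗ[ℝ] V} {l : List I}
    (hl_nodup : l.Nodup) (hl_mem : ∀ i : I, i ∈ l)
    (hC : C = ((l.map fun i => reflLM (Δ i)).prod : V →ₗ[ℝ] V))
    (hD₁ : D * ((1 : V →ₗ[ℝ] V) - C) = 1) {α β : V} (hα : α ∈ R) (hβ : β ∈ R) :
    ∃ n : ℤ, (⟪D α, β⟫ : ℝ) = n := by
  let G : AddSubgroup V :=
    { carrier := {x | ∀ i, ∃ n : ℤ, (⟪D x, Δ i⟫ : ℝ) = n}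
      zero_mem' := fun i => ⟨0, by simp⟩
      add_mem' := by
        intro x y hx hy i
        obtain ⟨n, hn⟩ := hx i
        obtain ⟨m, hm⟩ := hy i
        exact ⟨n + m, by rw [map_add, inner_add_left, hn, hm]; push_cast; ring⟩
      neg_mem' := by
        intro x hx i
        obtain ⟨n, hn⟩ := hx i
        exact ⟨-n, by rw [map_neg, inner_neg_left, hn]; push_cast; ring⟩ }
  have h1 : ∀ i, Δ i ∈ G := fun i =>
    simple_integral hR hΔ b hb hl_nodup hC hD₁ G (fun x => Iff.rfl) l [] (by simp) i (hl_mem i)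
  have h2 : α ∈ G := root_mem_of_simple hbase h1 hα
  let G' : AddSubgroup V :=
    { carrier := {y | ∃ n : ℤ, (⟪D α, y⟫ : ℝ) = n}
      zero_mem' := ⟨0, by simp⟩
      add_mem' := by
        rintro x y ⟨n, hn⟩ ⟨m, hm⟩
        exact ⟨n + m, by rw [inner_add_right, hn, hm]; push_cast; ring⟩
      neg_mem' := by
        rintro x ⟨n, hn⟩
        exact ⟨-n, by rw [inner_neg_right, hn]; push_cast; ring⟩ }
  exact root_mem_of_simple (G := G') hbase h2 hβ

theorem pairing_symm {C D : V →ₗ[ℝ] V} (hiso : ∀ x y, (⟪C x, C y⟫ : ℝ) = ⟪x, y⟫)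
    (hD₂ : ((1 : V →ₗ[ℝ] V) - C) * D = 1) (x y : V) :
    (⟪D x, y⟫ : ℝ) + ⟪D y, x⟫ = ⟪x, y⟫ := by
  have hx : x = D x - C (D x) := by
    have := LinearMap.congr_fun hD₂ x
    simpa [Module.End.mul_apply] using this.symm
  have hy : y = D y - C (D y) := by
    have := LinearMap.congr_fun hD₂ y
    simpa [Module.End.mul_apply] using this.symm
  have h1 : (⟪x, y⟫ : ℝ) = ⟪D x - C (D x), D y - C (D y)⟫ := by rw [← hx, ← hy]
  have h2 : (⟪D x, y⟫ : ℝ) = ⟪D x, D y - C (D y)⟫ := by rw [← hy]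
  have h3 : (⟪D y, x⟫ : ℝ) = ⟪D y, D x - C (D x)⟫ := by rw [← hx]
  rw [h1, h2, h3]
  simp only [inner_sub_left, inner_sub_right]
  rw [hiso, real_inner_comm (D y) (D x), real_inner_comm (D y) (C (D x))]
  ring

/-- The sign `(-1)^⟨x, y⟩`, extended to all of `V` through the exponential. -/
noncomputable def signExp (D : V →ₗ[ℝ] V) (x y : V) : ℂ :=
  Complex.exp (((⟪D x, y⟫ : ℝ) : ℂ) * (Real.pi * Complex.I))

theorem signExp_eq {D : V →ₗ[ℝ] V} {x y : V} {n : ℤ} (h : (⟪D x, y⟫ : ℝ) = n) :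
    signExp D x y = (-1 : ℂ) ^ n := by
  rw [signExp, h, Complex.ofReal_intCast, Complex.exp_int_mul, Complex.exp_pi_mul_I]

theorem neg_one_zpow_mul_self' (n : ℤ) : (-1 : ℂ) ^ n * (-1 : ℂ) ^ n = 1 := by
  rw [← mul_zpow]; simp

theorem signExp_isSignCocycle (hR : IsSimplyLacedRootSystem R) {D : V →ₗ[ℝ] V}
    (hintg : ∀ α ∈ R, ∀ β ∈ R, ∃ n : ℤ, (⟪D α, β⟫ : ℝ) = n)
    (hsym : ∀ x y, (⟪D x, y⟫ : ℝ) + ⟪D y, x⟫ = ⟪x, y⟫) : IsSignCocycle R (signExp D) where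
  add_left a b c := by
    simp only [signExp, map_add, inner_add_left, Complex.ofReal_add, add_mul, Complex.exp_add]
  add_right a b c := by
    simp only [signExp, inner_add_right, Complex.ofReal_add, add_mul, Complex.exp_add]
  neg_left α hα β hβ := by
    obtain ⟨n, hn⟩ := hintg α hα β hβ
    rw [signExp_eq hn, signExp_eq (n := -n) (by rw [map_neg, inner_neg_left, hn]; simp), zpow_neg]
    exact inv_eq_of_mul_eq_one_left (neg_one_zpow_mul_self' n)
  neg_right α hα β hβ := by
    obtain ⟨n, hn⟩ := hintg α hα β hβ
    rw [signExp_eq hn, signExp_eq (n := -n) (by rw [inner_neg_right, hn]; simp), zpow_neg]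
    exact inv_eq_of_mul_eq_one_left (neg_one_zpow_mul_self' n)
  sq α hα β hβ := by
    obtain ⟨n, hn⟩ := hintg α hα β hβ
    rw [signExp_eq hn, neg_one_zpow_mul_self']
  self α hα := by
    have h := hsym α α
    rw [hR.norm_two α hα] at h
    rw [signExp_eq (n := 1) (by push_cast; linarith), zpow_one]
  skew α hα β hβ hs := by
    obtain ⟨n, hn⟩ := hintg α hα β hβ
    have h := hsym α β
    rw [hR.inner_of_add_mem hα hβ hs, hn] at h
    rw [signExp_eq hn, signExp_eq (n := -n - 1) (by push_cast; linarith),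
      zpow_sub₀ (by norm_num), zpow_neg, inv_eq_of_mul_eq_one_left (neg_one_zpow_mul_self' n)]
    rw [zpow_one, div_neg, div_one]

end Coxeter

section TauC

variable {R : Finset V} {H : LieSubalgebra ℂ L} {χ : V → H → ℂ} {gsp : V → Submodule ℂ L}
  {Δ : I → V} {e f h : I → L}

theorem tau_prod_props (hR : IsSimplyLacedRootSystem R)
    (hg : IsRootSpaceDecomposition R H χ gsp)
    (hgen : AreChevalleyGenerators R gsp Δ e f h)
    (hh : ∀ i, ∀ β ∈ R, ∀ x ∈ gsp β, ⁅h i, x⁆ = ((⟪Δ i, β⟫ : ℝ) : ℂ) • x)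
    (τu : I → (Module.End ℂ L)ˣ)
    (hτu : ∀ i : I, (τu i : Module.End ℂ L) = chevalleyTau e f i) (p : List I) :
    (∀ u v : L, (((p.map τu).prod : (Module.End ℂ L)ˣ) : Module.End ℂ L) ⁅u, v⁆ =
      ⁅(((p.map τu).prod : (Module.End ℂ L)ˣ) : Module.End ℂ L) u,
        (((p.map τu).prod : (Module.End ℂ L)ˣ) : Module.End ℂ L) v⁆) ∧
    (∀ β ∈ R, ∀ x ∈ gsp β, (((p.map τu).prod : (Module.End ℂ L)ˣ) : Module.End ℂ L) x ∈
      gsp ((p.map fun i => reflLM (Δ i)).prod β)) := by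
  induction p with
  | nil => simp
  | cons a p ih =>
    obtain ⟨h1, h2⟩ := ih
    simp only [List.map_cons, List.prod_cons, Units.val_mul, Module.End.mul_apply, hτu]
    refine ⟨fun u v => by rw [h1, chevalleyTau_lie hgen], fun β hβ x hx => ?_⟩
    exact chevalleyTau_mem hR hg hgen a (hh a) (reflProd_mem hR hgen.base_mem p hβ) (h2 β hβ x hx)

theorem units_injective (u : (Module.End ℂ L)ˣ) {x : L} (hx : x ≠ 0) :
    (u : Module.End ℂ L) x ≠ 0 := by
  intro h0
  apply hx
  have h1 := LinearMap.congr_fun (Units.inv_mul u) x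
  rw [Module.End.mul_apply, h0, map_zero] at h1
  simpa using h1.symm

end TauC

/-- fix a Coxeter element `C` of the Weyl group and a base `Π = {Δ i}`
compatible with `C`, so `C = s_{i₁} ⋯ s_{i_r}` with each simple reflection occurring
exactly once (the list `l` enumerating `I`); set `τ_C = τ_{i₁} ∘ ⋯ ∘ τ_{i_r}` (the `τᵢ`
regarded as invertible endomorphisms, i.e. units `τu i` with `τu i = τᵢ`) and
`⟨x, y⟩ = ((1 − C)⁻¹ x, y)` (with `D = (1 − C)⁻¹`).  Then there is a family `(E_α)` of
nonzero root vectors `E_α ∈ g_α` with `[E_α, E_β] = (−1)^{⟨α,β⟩} E_{α+β}` whenever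
`α + β ∈ R`, `[E_α, E_β] = 0` whenever `α + β ∉ R` and `α ≠ −β`, and moreover
`τ_C(E_α) = E_{Cα}` for every `α ∈ R`. -/
theorem coxeter_element_gives_equivariant_root_basis
    (R : Finset V) (hR : IsSimplyLacedRootSystem R)
    (H : LieSubalgebra ℂ L) (χ : V → H → ℂ) (gsp : V → Submodule ℂ L)
    (hg : IsRootSpaceDecomposition R H χ gsp)
    (Δ : I → V) (e f h : I → L)
    (hgen : AreChevalleyGenerators R gsp Δ e f h)
    (C : V →ₗ[ℝ] V) (l : List I)
    (hl_nodup : l.Nodup) (hl_mem : ∀ i : I, i ∈ l)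
    (hC : C = ((l.map fun i => reflLM (Δ i)).prod : V →ₗ[ℝ] V))
    (τu : I → (Module.End ℂ L)ˣ)
    (hτu : ∀ i : I, (τu i : Module.End ℂ L) = chevalleyTau e f i)
    (D : V →ₗ[ℝ] V) (hD₁ : D * ((1 : V →ₗ[ℝ] V) - C) = 1)
    (hD₂ : ((1 : V →ₗ[ℝ] V) - C) * D = 1) :
    ∃ E : V → L,
      (∀ α ∈ R, E α ∈ gsp α ∧ E α ≠ 0) ∧
      (∀ α ∈ R, ∀ β ∈ R, ∀ n : ℤ, ⟪D α, β⟫ = (n : ℝ) → α + β ∈ R →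
        ⁅E α, E β⁆ = ((-1 : ℂ) ^ n) • E (α + β)) ∧
      (∀ α ∈ R, ∀ β ∈ R, α + β ∉ R → α ≠ -β → ⁅E α, E β⁆ = 0) ∧
      (∀ α ∈ R, (((l.map τu).prod : (Module.End ℂ L)ˣ) : Module.End ℂ L) (E α) =
        E (C α)) := by
  have hbase := hgen.base
  have hΔ := hgen.base_mem
  obtain ⟨b, hb⟩ := exists_basis_of_isBase hgen.base_inj hbase
  have hiso : ∀ x y, (⟪C x, C y⟫ : ℝ) = ⟪x, y⟫ := by
    rw [hC]; exact prod_isometry hR hΔ l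
  have hCR : ∀ x ∈ R, C x ∈ R := by
    rw [hC]; exact fun x hx => reflProd_mem hR hΔ l hx
  have hintg : ∀ α ∈ R, ∀ β ∈ R, ∃ n : ℤ, (⟪D α, β⟫ : ℝ) = n := fun α hα β hβ =>
    pairing_integral hR hΔ hbase b hb hl_nodup hl_mem hC hD₁ hα hβ
  have hε := signExp_isSignCocycle hR hintg (pairing_symm hiso hD₂)
  let ht : V →ₗ[ℝ] ℝ := b.constr ℝ (fun _ => (1 : ℝ))
  have hht : ∀ i, ht (Δ i) = 1 := fun i => by
    rw [← hb i]; exact b.constr_basis ℝ _ i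
  obtain ⟨E, hE, hbr, hact, hEe, hEf⟩ := exists_full_basis hR hg hε hgen hht
  have hh : ∀ i, ∀ β ∈ R, ∀ x ∈ gsp β, ⁅h i, x⁆ = ((⟪Δ i, β⟫ : ℝ) : ℂ) • x := by
    intro i β hβ x hx
    obtain ⟨c, rfl⟩ := exists_smul_of_mem hg hβ (hE β hβ).1 (hE β hβ).2 hx
    have h1 := hact (Δ i) (hΔ i) β hβ
    rw [hEe, hEf, neg_lie, lie_skew, ← hgen.h_eq] at h1
    rw [lie_smul, h1, smul_comm]
  obtain ⟨T1, T2⟩ := tau_prod_props hR hg hgen hh τu hτu l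
  rw [← hC] at T2
  have T3 : ∀ x : L, x ≠ 0 →
      (((l.map τu).prod : (Module.End ℂ L)ˣ) : Module.End ℂ L) x ≠ 0 :=
    fun x hx => units_injective _ hx
  generalize (((l.map τu).prod : (Module.End ℂ L)ˣ) : Module.End ℂ L) = T at T1 T2 T3 ⊢
  -- the scalars `c α`
  have hc : ∀ α ∈ R, ∃ c : ℂ, T (E α) = c • E (C α) := fun α hα =>
    exists_smul_of_mem hg (hCR α hα) (hE _ (hCR α hα)).1 (hE _ (hCR α hα)).2
      (T2 α hα _ (hE α hα).1)
  choose! c hc using hc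
  have hc0 : ∀ α ∈ R, c α ≠ 0 := by
    intro α hα h0
    have h1 := hc α hα
    rw [h0, zero_smul] at h1
    exact T3 _ (hE α hα).2 h1
  have hDC : ∀ x, D x - D (C x) = x := by
    intro x
    have := LinearMap.congr_fun hD₁ x
    simpa [Module.End.mul_apply] using this
  have hCD : ∀ x, D x - C (D x) = x := by
    intro x
    have := LinearMap.congr_fun hD₂ x
    simpa [Module.End.mul_apply] using this
  have hcomm : ∀ x, D (C x) = C (D x) := by
    intro x
    have h1 := (hDC x).trans (hCD x).symm
    exact sub_right_injective h1
  have hεC : ∀ x y, signExp D (C x) (C y) = signExp D x y := by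
    intro x y
    rw [signExp, signExp, hcomm, hiso]
  have εne : ∀ x y, signExp D x y ≠ 0 := fun x y => Complex.exp_ne_zero _
  have cadd : ∀ α ∈ R, ∀ β ∈ R, α + β ∈ R → c (α + β) = c α * c β := by
    intro α hα β hβ hs
    have hs' : C α + C β ∈ R := by rw [← map_add]; exact hCR _ hs
    have h1 := congrArg T (hbr α hα β hβ hs)
    rw [T1, hc α hα, hc β hβ, map_smul, hc _ hs, smul_lie, lie_smul,
      hbr _ (hCR α hα) _ (hCR β hβ) hs', hεC, map_add, smul_smul, smul_smul, smul_smul] at h1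
    have h2 := smul_left_injective ℂ (hE _ hs').2 h1
    have h3 : signExp D α β * c (α + β) = signExp D α β * (c α * c β) := by
      rw [← h2]; ring
    exact mul_left_cancel₀ (εne α β) h3
  have cneg : ∀ α ∈ R, c (-α) * c α = 1 := by
    intro α hα
    have hα' := hR.neg_mem hα
    have h1 := congrArg T (hact α hα α hα)
    rw [T1, T1, hc α hα, hc _ hα', map_smul, hc α hα, map_neg, smul_lie, lie_smul, smul_lie,
      lie_smul, smul_lie, hact _ (hCR α hα) _ (hCR α hα), hiso, hR.norm_two α hα, smul_smul,
      smul_smul, smul_smul, smul_smul] at h1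
    have h2 := smul_left_injective ℂ (hE _ (hCR α hα)).2 h1
    have h3 : (2 * c α) * (c (-α) * c α) = (2 * c α) * 1 := by
      push_cast at h2
      linear_combination h2
    exact mul_left_cancel₀ (mul_ne_zero two_ne_zero (hc0 α hα)) h3
  -- logarithm of `c`
  let lam : V →ₗ[ℝ] ℂ := b.constr ℝ (fun i => Complex.log (c (Δ i)))
  have hlam : ∀ i, Complex.exp (lam (Δ i)) = c (Δ i) := by
    intro i
    have : lam (Δ i) = Complex.log (c (Δ i)) := by
      rw [← hb i]
      exact (b.constr_basis ℝ _ i).trans (by rw [hb i])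
    rw [this, Complex.exp_log (hc0 _ (hΔ i))]
  have hexpP : ∀ α ∈ R, 0 < ht α → Complex.exp (lam α) = c α := by
    intro α hα pα
    refine pos_induction hR hbase hht (P := fun α => Complex.exp (lam α) = c α) hlam ?_ hα pα
    intro β hβ γ hγ _ _ hs h1 h2
    rw [map_add, Complex.exp_add, h1, h2, cadd β hβ γ hγ hs]
  have hexp : ∀ α ∈ R, Complex.exp (lam α) = c α := by
    intro α hα
    rcases lt_or_gt_of_ne (root_height hR hbase hht hα).2.1 with hlt | hgt
    · have h1 := hexpP (-α) (hR.neg_mem hα) (by simpa using hlt)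
      have h2 := cneg α hα
      rw [map_neg, Complex.exp_neg] at h1
      rw [← h1] at h2
      exact ((inv_mul_eq_one₀ (Complex.exp_ne_zero _)).1 h2)
    · exact hexpP α hα hgt
  refine ⟨fun α => Complex.exp (-lam (D α)) • E α, ?_, ?_, ?_, ?_⟩
  · intro α hα
    exact ⟨Submodule.smul_mem _ _ (hE α hα).1, smul_ne_zero (Complex.exp_ne_zero _) (hE α hα).2⟩
  · intro α hα β hβ n hn hs
    beta_reduce
    rw [smul_lie, lie_smul, hbr α hα β hβ hs, signExp_eq hn, map_add D, map_add lam, neg_add,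
      Complex.exp_add, smul_smul, smul_smul, smul_smul]
    congr 1
    ring
  · intro α hα β hβ hs hne
    beta_reduce
    rw [smul_lie, lie_smul, hg.bracket_eq_zero α hα β hβ hs
      (fun h0 => hne (eq_neg_of_add_eq_zero_left h0)) _ (hE α hα).1 _ (hE β hβ).1]
    simp
  · intro α hα
    beta_reduce
    rw [map_smul, hc α hα, smul_smul, ← hexp α hα, ← Complex.exp_add]
    congr 2
    have h1 : lam (D α) - lam (D (C α)) = lam α := by rw [← map_sub, hDC]
    linear_combination -h1
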